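/- arXiv:2412.13583 — 2 statements merged into one kernel-verified Lean document; each statement's English description precedes it below -/
import Mathlib

section
/- Fix L ∈ ℕ, a potential V : 𝔾 → ℝ, and let 𝒯_L = {H^{𝔾_L,S}, H^{𝔾_L,N}, H^{𝔾_L,D}, H^{G̃_L,S}, H^{G̃_L,N}, H^{G̃_L,D}}, where G̃_L is the truncated 2^L-triangle obtained from 𝔾_L by removing its three extreme vertices. Then for any two operators X, Y ∈ 𝒯_L and every E ∈ ℝ, |𝒩(E;X) − 𝒩(E;Y)| ≤ 9. -/
open scoped Classical

noncomputable section

namespace SGL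

/-- The vector `a₂ = (1,0)`. -/
def a2 : ℝ × ℝ := (1, 0)

/-- The vector `a₃ = (1/2, √3/2)`. -/
def a3 : ℝ × ℝ := (1/2, Real.sqrt 3 / 2)

/-- The vertex set of the unit triangle with lower-left corner `t`. -/
def tri (t : ℝ × ℝ) : Finset (ℝ × ℝ) := {t, t + a2, t + a3}

/-- The lower-left corners of the unit triangles making up `Tₙ`:
`T_{n+1} = T_n ∪ (T_n + 2ⁿ a₂) ∪ (T_n + 2ⁿ a₃)`. -/
def baseSet : ℕ → Finset (ℝ × ℝ)
  | 0 => {(0, 0)}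
  | (n+1) => baseSet n ∪ (baseSet n).image (· + (2 ^ n : ℝ) • a2)
      ∪ (baseSet n).image (· + (2 ^ n : ℝ) • a3)

/-- `𝔾ₙ`: the set of all vertices of the unit triangles composing `Tₙ`. -/
def VtxF (n : ℕ) : Finset (ℝ × ℝ) := (baseSet n).biUnion tri

/-- Reflection across the `y`-axis. -/
def reflY (p : ℝ × ℝ) : ℝ × ℝ := (-p.1, p.2)

/-- `(x,y) ∈ ℰₙ`: `x ≠ y` lie in a common unit triangle of `Tₙ`. -/
def EdgeIn (n : ℕ) (x y : ℝ × ℝ) : Prop :=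
  ∃ t ∈ baseSet n, x ∈ tri t ∧ y ∈ tri t ∧ x ≠ y

/-- Adjacency in the full Sierpinski lattice: an edge of some `ℰₙ` or of its mirror `ℰₙ′`. -/
def Adj (x y : ℝ × ℝ) : Prop :=
  (∃ n, EdgeIn n x y) ∨ (∃ n, EdgeIn n (reflY x) (reflY y))

/-- The vertex set `𝔾 = ⋃ₙ (𝔾ₙ ∪ 𝔾ₙ′)` of the full Sierpinski lattice. -/
def SG : Set (ℝ × ℝ) :=
  (⋃ n, (VtxF n : Set (ℝ × ℝ))) ∪ reflY '' (⋃ n, (VtxF n : Set (ℝ × ℝ)))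

/-- The type of vertices of the Sierpinski lattice. -/
abbrev Gpt := {p : ℝ × ℝ // p ∈ SG}

/-- `ℓ²(𝔾)` with real coefficients. -/
abbrev l2G := lp (fun _ : Gpt => ℝ) 2

/-- The essential support of a measure on `ℝ`. -/
def essSupp (P₀ : MeasureTheory.Measure ℝ) : Set ℝ :=
  {t : ℝ | ∀ ε > 0, 0 < P₀ (Set.Ioo (t - ε) (t + ε))}

end SGL

end

namespace SGL

/-- Degree of `x` in the full Sierpinski lattice `𝔾`. -/
noncomputable def degG (x : ℝ × ℝ) : ℕ := Set.ncard {y : ℝ × ℝ | Adj x y}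

/-- Degree of `x` within the subgraph induced by the finite vertex set `A`. -/
noncomputable def degIn (A : Finset (ℝ × ℝ)) (x : ℝ × ℝ) : ℕ :=
  (A.filter fun y => Adj x y).card

/-- Diagonal term for the three boundary conditions: `0 = S` (simple, i.e. `deg(x)`),
`1 = N` (Neumann, i.e. `deg_A(x)`), `2 = D` (modified Dirichlet, i.e. `2deg(x) − deg_A(x)`). -/
noncomputable def bcDiag : Fin 3 → Finset (ℝ × ℝ) → (ℝ × ℝ) → ℝ
  | 0, _, x => (degG x : ℝ)
  | 1, A, x => (degIn A x : ℝ)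
  | 2, A, x => 2 * (degG x : ℝ) - (degIn A x : ℝ)

/-- The matrix of `H^{A,•} = −Δ^{A,•} + V|_A` acting on `ℓ²(A)`, for boundary condition `b`. -/
noncomputable def HMat (b : Fin 3) (A : Finset (ℝ × ℝ)) (V : ℝ × ℝ → ℝ) :
    Matrix A A ℝ := fun x y =>
  (if (x : ℝ × ℝ) = (y : ℝ × ℝ) then bcDiag b A (x : ℝ × ℝ) + V (x : ℝ × ℝ) else 0)
    - (if Adj (x : ℝ × ℝ) (y : ℝ × ℝ) then 1 else 0)

/-- The eigenvalue counting function `𝒩(E;M)`: the number of eigenvalues of `M` that are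
`≤ E`, counted with multiplicity (the dimension of the span of the eigenspaces with
eigenvalue `≤ E`; for symmetric `M` this is the usual count). -/
noncomputable def evCount {ι : Type} [Fintype ι] (M : Matrix ι ι ℝ) (E : ℝ) : ℕ :=
  Module.finrank ℝ
    ↥(⨆ μ : {μ : ℝ // μ ≤ E}, Module.End.eigenspace (Matrix.mulVecLin M) (μ : ℝ))

/-- The three corner (extreme) vertices of `𝔾_ℓ`. -/
noncomputable def cornerF (ℓ : ℕ) : Finset (ℝ × ℝ) :=
  {(0, 0), (2 ^ ℓ : ℝ) • a2, (2 ^ ℓ : ℝ) • a3}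

/-- The truncated triangle `G̃_ℓ = 𝔾_ℓ` minus its three extreme vertices. -/
noncomputable def TruncF (ℓ : ℕ) : Finset (ℝ × ℝ) := VtxF ℓ \ cornerF ℓ

end SGL

namespace SGL

/-- Extension by zero along `f`. -/
noncomputable def extendZero {ι κ : Type} (f : κ → ι) : (κ → ℝ) →ₗ[ℝ] (ι → ℝ) :=
  Function.ExtendByZero.linearMap ℝ f

lemma extendZero_injective {ι κ : Type} {f : κ → ι} (hf : Function.Injective f) :
    Function.Injective (extendZero f) := by
  intro x y h
  funext k
  simpa [extendZero, hf.extend_apply] using congrFun h (f k)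

section Counting

variable {ι κ : Type} [Fintype ι] [Fintype κ]

/-- The span of the eigenvectors of `M` with eigenvalue at most `E`. -/
noncomputable def lowSpace (M : Matrix ι ι ℝ) (E : ℝ) : Submodule ℝ (ι → ℝ) :=
  ⨆ μ : {μ : ℝ // μ ≤ E}, Module.End.eigenspace (Matrix.mulVecLin M) (μ : ℝ)

/-- An orthogonal diagonalization of a real symmetric matrix. -/
lemma exists_orthogonal_diagonalization {M : Matrix ι ι ℝ} (hM : M.IsHermitian) :
    ∃ (U : Matrix ι ι ℝ) (d : ι → ℝ), U.transpose * U = 1 ∧ U * U.transpose = 1 ∧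
      M = U * Matrix.diagonal d * U.transpose := by
  refine ⟨hM.eigenvectorUnitary, hM.eigenvalues, ?_, ?_, ?_⟩
  · have h := Matrix.mem_unitaryGroup_iff'.1 hM.eigenvectorUnitary.2
    rwa [Matrix.star_eq_conjTranspose, Matrix.conjTranspose_eq_transpose_of_trivial] at h
  · have h := Matrix.mem_unitaryGroup_iff.1 hM.eigenvectorUnitary.2
    rwa [Matrix.star_eq_conjTranspose, Matrix.conjTranspose_eq_transpose_of_trivial] at h
  · have h := hM.spectral_theorem
    rw [Unitary.conjStarAlgAut_apply] at h
    rw [Matrix.star_eq_conjTranspose, Matrix.conjTranspose_eq_transpose_of_trivial] at h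
    exact h

open Matrix in
lemma dotProduct_mulVec_diagonalization {U M : Matrix ι ι ℝ} {d : ι → ℝ}
    (hM : M = U * Matrix.diagonal d * Uᵀ) (x : ι → ℝ) :
    x ⬝ᵥ M *ᵥ x = ∑ i, d i * (Uᵀ *ᵥ x) i ^ 2 := by
  rw [hM, ← mulVec_mulVec, ← mulVec_mulVec, dotProduct_mulVec, ← mulVec_transpose]
  simp only [dotProduct, mulVec_diagonal]
  exact Finset.sum_congr rfl fun i _ => by ring

open Matrix in
lemma dotProduct_self_diagonalization {U : Matrix ι ι ℝ} (hU : U * Uᵀ = 1) (x : ι → ℝ) :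
    x ⬝ᵥ x = ∑ i, (Uᵀ *ᵥ x) i ^ 2 := by
  have h : x ⬝ᵥ x = x ⬝ᵥ (U * Uᵀ) *ᵥ x := by rw [hU, one_mulVec]
  rw [h, ← mulVec_mulVec, dotProduct_mulVec, ← mulVec_transpose]
  simp only [dotProduct]
  exact Finset.sum_congr rfl fun i _ => by ring

open Matrix in
/-- The quadratic form of a symmetric matrix is at most `E` on `lowSpace M E`. -/
lemma dotProduct_mulVec_le_of_mem_lowSpace {M : Matrix ι ι ℝ} (hM : M.IsHermitian) {E : ℝ}
    {x : ι → ℝ} (hx : x ∈ lowSpace M E) : x ⬝ᵥ M *ᵥ x ≤ E * (x ⬝ᵥ x) := by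
  obtain ⟨U, d, hUU, hUU', hMU⟩ := exists_orthogonal_diagonalization hM
  have hle : lowSpace M E ≤ ⨅ i : {i // E < d i},
      LinearMap.ker ((LinearMap.proj (i : ι) : (ι → ℝ) →ₗ[ℝ] ℝ) ∘ₗ Uᵀ.mulVecLin) := by
    refine iSup_le fun μ => le_iInf fun i => ?_
    intro v hv
    have hv' : M *ᵥ v = (μ : ℝ) • v := Module.End.mem_eigenspace_iff.1 hv
    have h2 : Uᵀ *ᵥ (M *ᵥ v) = Matrix.diagonal d *ᵥ (Uᵀ *ᵥ v) := by
      rw [hMU, mulVec_mulVec, mulVec_mulVec, ← Matrix.mul_assoc, ← Matrix.mul_assoc, hUU,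
        Matrix.one_mul]
    rw [hv', mulVec_smul] at h2
    have h3 := congrFun h2 i
    rw [mulVec_diagonal, Pi.smul_apply, smul_eq_mul] at h3
    have h4 : (d i - μ) * (Uᵀ *ᵥ v) i = 0 := by linarith
    have h5 : d i - μ ≠ 0 := by have := i.2; have := μ.2; intro h; linarith
    exact LinearMap.mem_ker.2 ((mul_eq_zero.1 h4).resolve_left h5)
  have hx' := hle hx
  rw [dotProduct_mulVec_diagonalization hMU, dotProduct_self_diagonalization hUU',
    Finset.mul_sum]
  refine Finset.sum_le_sum fun i _ => ?_
  by_cases hi : E < d i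
  · have : (Uᵀ *ᵥ x) i = 0 :=
      LinearMap.mem_ker.1 ((Submodule.mem_iInf _).1 hx' ⟨i, hi⟩)
    simp [this]
  · exact mul_le_mul_of_nonneg_right (not_lt.1 hi) (sq_nonneg _)

open Matrix in
/-- The variational lower bound: a subspace on which the quadratic form is at most `E` has
dimension at most `evCount M E`. -/
lemma finrank_le_evCount {M : Matrix ι ι ℝ} (hM : M.IsHermitian) {E : ℝ}
    (S : Submodule ℝ (ι → ℝ)) (hS : ∀ x ∈ S, x ⬝ᵥ M *ᵥ x ≤ E * (x ⬝ᵥ x)) :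
    Module.finrank ℝ S ≤ evCount M E := by
  obtain ⟨U, d, hUU, hUU', hMU⟩ := exists_orthogonal_diagonalization hM
  let c : S →ₗ[ℝ] ({i // d i ≤ E} → ℝ) :=
    (LinearMap.funLeft ℝ ℝ (Subtype.val : {i // d i ≤ E} → ι)) ∘ₗ Uᵀ.mulVecLin ∘ₗ S.subtype
  have hc : Function.Injective c := by
    rw [← LinearMap.ker_eq_bot, LinearMap.ker_eq_bot']
    intro x hx
    have h0 : ∀ i, d i ≤ E → (Uᵀ *ᵥ (x : ι → ℝ)) i = 0 := fun i hi => congrFun hx ⟨i, hi⟩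
    have h1 := hS x x.2
    rw [dotProduct_mulVec_diagonalization hMU, dotProduct_self_diagonalization hUU',
      Finset.mul_sum, ← sub_nonpos, ← Finset.sum_sub_distrib] at h1
    have hnn : ∀ i ∈ Finset.univ, 0 ≤ d i * (Uᵀ *ᵥ (x : ι → ℝ)) i ^ 2
        - E * (Uᵀ *ᵥ (x : ι → ℝ)) i ^ 2 := by
      intro i _
      by_cases hi : d i ≤ E
      · simp [h0 i hi]
      · rw [← sub_mul]
        exact mul_nonneg (by linarith) (sq_nonneg _)
    have h2 := (Finset.sum_eq_zero_iff_of_nonneg hnn).1 (le_antisymm h1 (Finset.sum_nonneg hnn))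
    have h3 : Uᵀ *ᵥ (x : ι → ℝ) = 0 := by
      funext i
      by_cases hi : d i ≤ E
      · exact h0 i hi
      · have h4 := h2 i (Finset.mem_univ i)
        rw [← sub_mul] at h4
        have h5 : d i - E ≠ 0 := by intro h; apply hi; linarith
        exact pow_eq_zero_iff two_ne_zero |>.1 ((mul_eq_zero.1 h4).resolve_left h5)
    have h6 : (x : ι → ℝ) = U *ᵥ (Uᵀ *ᵥ (x : ι → ℝ)) := by
      rw [mulVec_mulVec, hUU', one_mulVec]
    rw [h3, mulVec_zero] at h6
    exact Subtype.ext h6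
  have hcard : Module.finrank ℝ S ≤ Fintype.card {i // d i ≤ E} := by
    simpa using LinearMap.finrank_le_finrank_of_injective hc
  refine hcard.trans ?_
  have hmem : ∀ i : {i // d i ≤ E}, U.col i ∈ lowSpace M E := by
    intro i
    refine (le_iSup (fun μ : {μ : ℝ // μ ≤ E} =>
      Module.End.eigenspace (Matrix.mulVecLin M) (μ : ℝ)) ⟨d i, i.2⟩) ?_
    rw [Module.End.mem_eigenspace_iff, mulVecLin_apply]
    have : M * U = U * Matrix.diagonal d := by
      rw [hMU, Matrix.mul_assoc, hUU, Matrix.mul_one]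
    funext j
    have h := congrFun (congrFun this j) i
    rw [mul_diagonal] at h
    simpa [Matrix.mul_apply, mulVec, dotProduct, mul_comm] using h
  have hli : LinearIndependent ℝ (fun i : {i // d i ≤ E} => U.col i) := by
    have hu : IsUnit U := ⟨⟨U, Uᵀ, hUU', hUU⟩, rfl⟩
    exact (Matrix.linearIndependent_cols_of_isUnit hu).comp _ Subtype.val_injective
  have hli' : LinearIndependent ℝ
      (fun i : {i // d i ≤ E} => (⟨U.col i, hmem i⟩ : lowSpace M E)) :=
    LinearIndependent.of_comp (lowSpace M E).subtype hli
  exact hli'.fintype_card_le_finrank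

lemma sum_extendZero_mul {f : κ → ι} (hf : Function.Injective f) (x : κ → ℝ) (g : ι → ℝ) :
    ∑ i, extendZero f x i * g i = ∑ k, x k * g (f k) := by
  symm
  refine Finset.sum_of_injOn f hf.injOn (fun _ _ => Finset.mem_univ _) ?_ ?_
  · intro i _ hi
    have : ¬ ∃ k, f k = i := by simpa using hi
    simp [extendZero, Function.extend_apply' _ _ _ this]
  · intro k _
    simp [extendZero, hf.extend_apply]

open Matrix in
lemma dotProduct_mulVec_extendZero {f : κ → ι} (hf : Function.Injective f)
    (M : Matrix ι ι ℝ) (x : κ → ℝ) :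
    extendZero f x ⬝ᵥ M *ᵥ extendZero f x = x ⬝ᵥ M.submatrix f f *ᵥ x := by
  rw [dotProduct, sum_extendZero_mul hf, dotProduct]
  refine Finset.sum_congr rfl fun k _ => ?_
  congr 1
  simp only [mulVec, dotProduct, submatrix_apply]
  simp_rw [mul_comm (M _ _)]
  exact sum_extendZero_mul hf _ _

open Matrix in
lemma dotProduct_self_extendZero {f : κ → ι} (hf : Function.Injective f) (x : κ → ℝ) :
    extendZero f x ⬝ᵥ extendZero f x = x ⬝ᵥ x := by
  rw [dotProduct, sum_extendZero_mul hf, dotProduct]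
  simp [extendZero, hf.extend_apply]

/-- Cauchy interlacing, lower bound. -/
lemma evCount_submatrix_le {M : Matrix ι ι ℝ} (hM : M.IsHermitian) {f : κ → ι}
    (hf : Function.Injective f) (E : ℝ) : evCount (M.submatrix f f) E ≤ evCount M E := by
  have h := finrank_le_evCount (E := E) hM
    ((lowSpace (M.submatrix f f) E).map (extendZero f)) (by
      rintro _ ⟨x, hx, rfl⟩
      rw [dotProduct_mulVec_extendZero hf, dotProduct_self_extendZero hf]
      exact dotProduct_mulVec_le_of_mem_lowSpace (hM.submatrix f) hx)
  rwa [← (Submodule.equivMapOfInjective _ (extendZero_injective hf) _).finrank_eq] at h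

/-- Cauchy interlacing, upper bound. -/
lemma evCount_le_evCount_submatrix_add {M : Matrix ι ι ℝ} (hM : M.IsHermitian) {f : κ → ι}
    (hf : Function.Injective f) (E : ℝ) :
    evCount M E + Fintype.card κ ≤ evCount (M.submatrix f f) E + Fintype.card ι := by
  have h := finrank_le_evCount (E := E) (hM.submatrix f)
    ((lowSpace M E).comap (extendZero f)) (by
      intro x hx
      rw [← dotProduct_mulVec_extendZero hf, ← dotProduct_self_extendZero hf]
      exact dotProduct_mulVec_le_of_mem_lowSpace hM hx)
  have h1 : Module.finrank ℝ ((lowSpace M E).comap (extendZero f)) =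
      Module.finrank ℝ (lowSpace M E ⊓ LinearMap.range (extendZero f) :
        Submodule ℝ (ι → ℝ)) := by
    rw [(Submodule.equivMapOfInjective _ (extendZero_injective hf) _).finrank_eq,
      Submodule.map_comap_eq, inf_comm]
  have h2 : Module.finrank ℝ (LinearMap.range (extendZero f)) = Fintype.card κ := by
    rw [LinearMap.finrank_range_of_inj (extendZero_injective hf),
      Module.finrank_fintype_fun_eq_card]
  have h3 := Submodule.finrank_sup_add_finrank_inf_eq (lowSpace M E)
    (LinearMap.range (extendZero f))
  have h4 := Submodule.finrank_le (lowSpace M E ⊔ LinearMap.range (extendZero f))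
  rw [Module.finrank_fintype_fun_eq_card] at h4
  have h5 : evCount M E = Module.finrank ℝ (lowSpace M E) := rfl
  omega

end Counting

section Lattice

/-- First coordinate with respect to the basis `a₂, a₃`. -/
noncomputable def coordU (p : ℝ × ℝ) : ℝ := p.1 - p.2 / Real.sqrt 3

/-- Second coordinate with respect to the basis `a₂, a₃`. -/
noncomputable def coordV (p : ℝ × ℝ) : ℝ := 2 * p.2 / Real.sqrt 3

lemma coordU_add (p q : ℝ × ℝ) : coordU (p + q) = coordU p + coordU q := by
  simp only [coordU, Prod.fst_add, Prod.snd_add]; ring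

lemma coordV_add (p q : ℝ × ℝ) : coordV (p + q) = coordV p + coordV q := by
  simp only [coordV, Prod.snd_add]; ring

lemma coordU_smul (r : ℝ) (p : ℝ × ℝ) : coordU (r • p) = r * coordU p := by
  simp only [coordU, Prod.smul_fst, Prod.smul_snd, smul_eq_mul]; ring

lemma coordV_smul (r : ℝ) (p : ℝ × ℝ) : coordV (r • p) = r * coordV p := by
  simp only [coordV, Prod.smul_snd, smul_eq_mul]; ring

lemma coordU_a2 : coordU a2 = 1 := by simp [coordU, a2]

lemma coordV_a2 : coordV a2 = 0 := by simp [coordV, a2]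

lemma coordU_a3 : coordU a3 = 0 := by
  have : Real.sqrt 3 ≠ 0 := by positivity
  simp only [coordU, a3]; field_simp; norm_num

lemma coordV_a3 : coordV a3 = 1 := by
  have : Real.sqrt 3 ≠ 0 := by positivity
  simp only [coordV, a3]; field_simp

lemma coordU_zero : coordU (0, 0) = 0 := by simp [coordU]

lemma coordV_zero : coordV (0, 0) = 0 := by simp [coordV]

lemma coordU_reflY (p : ℝ × ℝ) : coordU (reflY p) = -coordU p - coordV p := by
  simp only [coordU, coordV, reflY]; ring

lemma ext_coord {p q : ℝ × ℝ} (hu : coordU p = coordU q) (hv : coordV p = coordV q) :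
    p = q := by
  have h3 : Real.sqrt 3 ≠ 0 := by positivity
  have h2 : p.2 = q.2 := by
    simp only [coordV] at hv
    field_simp at hv
    linarith
  refine Prod.ext ?_ h2
  simp only [coordU, h2] at hu
  linarith

lemma mem_tri {x t : ℝ × ℝ} : x ∈ tri t ↔ x = t ∨ x = t + a2 ∨ x = t + a3 := by
  simp [tri]

lemma coord_of_mem_baseSet {n : ℕ} : ∀ {t : ℝ × ℝ}, t ∈ baseSet n →
    0 ≤ coordU t ∧ 0 ≤ coordV t ∧ coordU t + coordV t ≤ 2 ^ n - 1 := by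
  induction n with
  | zero =>
    intro t ht
    have : t = (0, 0) := by simpa [baseSet] using ht
    subst this
    simp [coordU_zero, coordV_zero]
  | succ n ih =>
    intro t ht
    have hp : (0 : ℝ) < 2 ^ n := by positivity
    simp only [baseSet, Finset.mem_union, Finset.mem_image] at ht
    rw [pow_succ]
    rcases ht with (ht | ⟨s, hs, rfl⟩) | ⟨s, hs, rfl⟩
    · obtain ⟨h1, h2, h3⟩ := ih ht
      exact ⟨h1, h2, by linarith⟩
    · obtain ⟨h1, h2, h3⟩ := ih hs
      simp only [coordU_add, coordV_add, coordU_smul, coordV_smul, coordU_a2, coordV_a2]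
      exact ⟨by linarith, by linarith, by linarith⟩
    · obtain ⟨h1, h2, h3⟩ := ih hs
      simp only [coordU_add, coordV_add, coordU_smul, coordV_smul, coordU_a3, coordV_a3]
      exact ⟨by linarith, by linarith, by linarith⟩

lemma coord_of_mem_tri {x t : ℝ × ℝ} (h : x ∈ tri t) :
    coordU t ≤ coordU x ∧ coordV t ≤ coordV x ∧
      coordU x + coordV x ≤ coordU t + coordV t + 1 := by
  rcases mem_tri.1 h with rfl | rfl | rfl <;>
    try simp only [coordU_add, coordV_add, coordU_a2, coordV_a2, coordU_a3, coordV_a3]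
  all_goals refine ⟨?_, ?_, ?_⟩ <;> linarith

lemma coord_of_mem_VtxF {n : ℕ} {x : ℝ × ℝ} (hx : x ∈ VtxF n) :
    0 ≤ coordU x ∧ 0 ≤ coordV x ∧ coordU x + coordV x ≤ 2 ^ n := by
  obtain ⟨t, ht, hxt⟩ := Finset.mem_biUnion.1 hx
  obtain ⟨h1, h2, h3⟩ := coord_of_mem_baseSet ht
  obtain ⟨h4, h5, h6⟩ := coord_of_mem_tri hxt
  exact ⟨by linarith, by linarith, by linarith⟩

lemma baseSet_mono : Monotone baseSet :=
  monotone_nat_of_le_succ fun _ _ h =>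
    Finset.mem_union_left _ (Finset.mem_union_left _ h)

/-- A unit triangle of the lattice which meets `VtxF L` outside of the corners lies in `T_L`. -/
lemma mem_baseSet_of_mem_tri {L n : ℕ} {x t : ℝ × ℝ} (hx : x ∈ VtxF L) (hc : x ∉ cornerF L)
    (ht : t ∈ baseSet n) (hxt : x ∈ tri t) : t ∈ baseSet L := by
  induction n generalizing t with
  | zero => exact baseSet_mono (Nat.zero_le L) ht
  | succ n ih =>
    rcases Nat.lt_or_ge n L with hn | hn
    · exact baseSet_mono hn ht
    have hp : (2 : ℝ) ^ L ≤ 2 ^ n := pow_le_pow_right₀ one_le_two hn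
    obtain ⟨h1, h2, h3⟩ := coord_of_mem_VtxF hx
    obtain ⟨h4, h5, h6⟩ := coord_of_mem_tri hxt
    simp only [baseSet, Finset.mem_union, Finset.mem_image] at ht
    rcases ht with (ht | ⟨s, hs, rfl⟩) | ⟨s, hs, rfl⟩
    · exact ih ht hxt
    · obtain ⟨h7, h8, h9⟩ := coord_of_mem_baseSet hs
      simp only [coordU_add, coordV_add, coordU_smul, coordV_smul, coordU_a2, coordV_a2] at h4 h5
      refine absurd ?_ hc
      have : x = (2 ^ L : ℝ) • a2 := by
        apply ext_coord <;> simp only [coordU_smul, coordV_smul, coordU_a2, coordV_a2] <;> linarith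
      simp [cornerF, this]
    · obtain ⟨h7, h8, h9⟩ := coord_of_mem_baseSet hs
      simp only [coordU_add, coordV_add, coordU_smul, coordV_smul, coordU_a3, coordV_a3] at h4 h5
      refine absurd ?_ hc
      have : x = (2 ^ L : ℝ) • a3 := by
        apply ext_coord <;> simp only [coordU_smul, coordV_smul, coordU_a3, coordV_a3] <;> linarith
      simp [cornerF, this]

lemma EdgeIn.symm {n : ℕ} {x y : ℝ × ℝ} (h : EdgeIn n x y) : EdgeIn n y x := by
  obtain ⟨t, ht, hx, hy, hne⟩ := h
  exact ⟨t, ht, hy, hx, hne.symm⟩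

lemma Adj.symm {x y : ℝ × ℝ} (h : Adj x y) : Adj y x :=
  h.imp (fun ⟨n, h⟩ => ⟨n, h.symm⟩) (fun ⟨n, h⟩ => ⟨n, h.symm⟩)

lemma adj_comm (x y : ℝ × ℝ) : Adj x y ↔ Adj y x := ⟨Adj.symm, Adj.symm⟩

/-- An edge of the mirror image starting at a point of `VtxF L` starts at the origin. -/
lemma eq_zero_of_reflected_edge {L n : ℕ} {x y : ℝ × ℝ} (hx : x ∈ VtxF L)
    (h : EdgeIn n (reflY x) (reflY y)) : x = (0, 0) := by
  obtain ⟨t, ht, hxt, -, -⟩ := h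
  obtain ⟨h1, h2, h3⟩ := coord_of_mem_VtxF hx
  obtain ⟨h4, h5, h6⟩ := coord_of_mem_tri hxt
  obtain ⟨h7, h8, h9⟩ := coord_of_mem_baseSet ht
  rw [coordU_reflY] at h4
  apply ext_coord
  · rw [coordU_zero]; linarith
  · rw [coordV_zero]; linarith

/-- All neighbours of a non-extreme vertex of `VtxF L` lie in `VtxF L`. -/
lemma mem_VtxF_of_adj {L : ℕ} {x y : ℝ × ℝ} (hx : x ∈ VtxF L) (hc : x ∉ cornerF L)
    (h : Adj x y) : y ∈ VtxF L := by
  rcases h with ⟨n, t, ht, hxt, hyt, -⟩ | ⟨n, h⟩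
  · exact Finset.mem_biUnion.2 ⟨t, mem_baseSet_of_mem_tri hx hc ht hxt, hyt⟩
  · exact absurd (by simp [cornerF, eq_zero_of_reflected_edge hx h]) hc

/-- The three extreme vertices of `VtxF L` together with their inner neighbours. -/
noncomputable def cornerNbhd (L : ℕ) : Finset (ℝ × ℝ) :=
  {(0, 0), (2 ^ L : ℝ) • a2, (2 ^ L : ℝ) • a3,
    a2, a3,
    (2 ^ L - 1 : ℝ) • a2, (2 ^ L - 1 : ℝ) • a2 + a3,
    (2 ^ L - 1 : ℝ) • a3, (2 ^ L - 1 : ℝ) • a3 + a2}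

lemma card_cornerNbhd_le (L : ℕ) : (cornerNbhd L).card ≤ 9 := by
  unfold cornerNbhd
  refine (Finset.card_insert_le _ _).trans (Nat.succ_le_succ ?_)
  refine (Finset.card_insert_le _ _).trans (Nat.succ_le_succ ?_)
  refine (Finset.card_insert_le _ _).trans (Nat.succ_le_succ ?_)
  exact Finset.card_le_six

lemma cornerF_subset_cornerNbhd (L : ℕ) : cornerF L ⊆ cornerNbhd L := by
  intro x hx
  simp only [cornerF, Finset.mem_insert, Finset.mem_singleton] at hx
  simp only [cornerNbhd, Finset.mem_insert, Finset.mem_singleton]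
  tauto

lemma mem_cornerNbhd_of_adj {L : ℕ} {x c : ℝ × ℝ} (hx : x ∈ VtxF L) (hxc : x ∉ cornerF L)
    (hc : c ∈ cornerF L) (h : Adj x c) : x ∈ cornerNbhd L := by
  rcases h with ⟨n, t, ht, hxt, hct, hne⟩ | ⟨n, h⟩
  swap
  · exact absurd (by simp [cornerF, eq_zero_of_reflected_edge hx h]) hxc
  obtain ⟨h1, h2, h3⟩ := coord_of_mem_VtxF hx
  obtain ⟨h7, h8, -⟩ := coord_of_mem_baseSet ht
  have hp : (0 : ℝ) < 2 ^ L := by positivity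
  have key : ∀ z ∈ cornerNbhd L, coordU x = coordU z → coordV x = coordV z →
      x ∈ cornerNbhd L := fun z hz hu hv => ext_coord hu hv ▸ hz
  have hcU : ∀ z, c = z → coordU c = coordU z ∧ coordV c = coordV z := by
    rintro z rfl; exact ⟨rfl, rfl⟩
  have hxU : ∀ z, x = z → coordU x = coordU z ∧ coordV x = coordV z := by
    rintro z rfl; exact ⟨rfl, rfl⟩
  have hc' : c = (0, 0) ∨ c = (2 ^ L : ℝ) • a2 ∨ c = (2 ^ L : ℝ) • a3 := by
    simpa [cornerF] using hc
  have e1 : a2 ∈ cornerNbhd L := by simp [cornerNbhd]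
  have e2 : a3 ∈ cornerNbhd L := by simp [cornerNbhd]
  have e3 : (2 ^ L - 1 : ℝ) • a2 ∈ cornerNbhd L := by simp [cornerNbhd]
  have e4 : (2 ^ L - 1 : ℝ) • a2 + a3 ∈ cornerNbhd L := by simp [cornerNbhd]
  have e5 : (2 ^ L - 1 : ℝ) • a3 ∈ cornerNbhd L := by simp [cornerNbhd]
  have e6 : (2 ^ L - 1 : ℝ) • a3 + a2 ∈ cornerNbhd L := by simp [cornerNbhd]
  have k1 := key _ e1
  have k2 := key _ e2
  have k3 := key _ e3
  have k4 := key _ e4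
  have k5 := key _ e5
  have k6 := key _ e6
  simp only [coordU_add, coordV_add, coordU_smul, coordV_smul, coordU_a2, coordV_a2,
    coordU_a3, coordV_a3] at k1 k2 k3 k4 k5 k6
  rcases mem_tri.1 hct with hct | hct | hct <;> obtain ⟨p1, p2⟩ := hcU _ hct <;>
  rcases mem_tri.1 hxt with hxt | hxt | hxt <;> obtain ⟨q1, q2⟩ := hxU _ hxt <;>
  first
  | exact absurd (hxt.trans hct.symm) hne
  | (rcases hc' with hc' | hc' | hc' <;> obtain ⟨r1, r2⟩ := hcU _ hc' <;>
    simp only [coordU_add, coordV_add, coordU_smul, coordV_smul, coordU_a2, coordV_a2,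
      coordU_a3, coordV_a3, coordU_zero, coordV_zero] at p1 p2 q1 q2 r1 r2 <;>
    first
    | (exfalso; linarith)
    | exact k1 (by linarith) (by linarith)
    | exact k2 (by linarith) (by linarith)
    | exact k3 (by linarith) (by linarith)
    | exact k4 (by linarith) (by linarith)
    | exact k5 (by linarith) (by linarith)
    | exact k6 (by linarith) (by linarith))

/-- The vertices of the truncated triangle all of whose neighbours lie in it. -/
noncomputable def deepF (L : ℕ) : Finset (ℝ × ℝ) :=
  (TruncF L).filter fun x => ∀ y, Adj x y → y ∈ TruncF L

lemma deepF_subset_TruncF (L : ℕ) : deepF L ⊆ TruncF L := Finset.filter_subset _ _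

lemma TruncF_subset_VtxF (L : ℕ) : TruncF L ⊆ VtxF L := Finset.sdiff_subset

lemma mem_TruncF_of_adj {L : ℕ} {x y : ℝ × ℝ} (hx : x ∈ deepF L) (h : Adj x y) :
    y ∈ TruncF L := (Finset.mem_filter.1 hx).2 y h

lemma VtxF_sdiff_deepF_subset (L : ℕ) : VtxF L \ deepF L ⊆ cornerNbhd L := by
  intro x hx
  obtain ⟨hxA, hxW⟩ := Finset.mem_sdiff.1 hx
  by_cases hc : x ∈ cornerF L
  · exact cornerF_subset_cornerNbhd L hc
  have : ∃ y, Adj x y ∧ y ∉ TruncF L := by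
    by_contra! hcon
    exact hxW (Finset.mem_filter.2 ⟨Finset.mem_sdiff.2 ⟨hxA, hc⟩, hcon⟩)
  obtain ⟨y, hxy, hy⟩ := this
  have hyA := mem_VtxF_of_adj hxA hc hxy
  have hyc : y ∈ cornerF L := by
    by_contra hyc
    exact hy (Finset.mem_sdiff.2 ⟨hyA, hyc⟩)
  exact mem_cornerNbhd_of_adj hxA hc hyc hxy

lemma card_VtxF_le (L : ℕ) : (VtxF L).card ≤ (deepF L).card + 9 := by
  have h1 := Finset.card_sdiff_add_card_eq_card
    ((deepF_subset_TruncF L).trans (TruncF_subset_VtxF L))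
  have h2 := (Finset.card_le_card (VtxF_sdiff_deepF_subset L)).trans (card_cornerNbhd_le L)
  omega

end Lattice

lemma degIn_eq_degG {A : Finset (ℝ × ℝ)} {x : ℝ × ℝ} (h : ∀ y, Adj x y → y ∈ A) :
    degIn A x = degG x := by
  rw [degIn, degG, ← Set.ncard_coe_finset]
  congr 1
  ext y
  simpa using h y

lemma bcDiag_eq_degG (b : Fin 3) {A : Finset (ℝ × ℝ)} {x : ℝ × ℝ}
    (h : ∀ y, Adj x y → y ∈ A) : bcDiag b A x = degG x := by
  fin_cases b <;> simp only [bcDiag, degIn_eq_degG h]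
  ring

lemma HMat_isHermitian (b : Fin 3) (A : Finset (ℝ × ℝ)) (V : ℝ × ℝ → ℝ) :
    (HMat b A V).IsHermitian := by
  ext x y
  simp only [Matrix.conjTranspose_apply, star_trivial, HMat, adj_comm (y : ℝ × ℝ)]
  by_cases h : (x : ℝ × ℝ) = y
  · simp [h]
  · simp [h, Ne.symm h]

/-- The counting functions on `A` and on a subset `W`, all of whose neighbours lie in `A`, differ
by at most the number of vertices removed. -/
lemma evCount_HMat_bounds (b : Fin 3) {A W : Finset (ℝ × ℝ)} (hWA : W ⊆ A)
    (hadj : ∀ x ∈ W, ∀ y, Adj x y → y ∈ A) (V : ℝ × ℝ → ℝ) (E : ℝ) :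
    evCount (HMat 0 W V) E ≤ evCount (HMat b A V) E ∧
      evCount (HMat b A V) E + W.card ≤ evCount (HMat 0 W V) E + A.card := by
  let f : W → A := fun w => ⟨w, hWA w.2⟩
  have hf : Function.Injective f := fun x y h =>
    Subtype.ext (congrArg (fun z : A => (z : ℝ × ℝ)) h)
  have hsub : (HMat b A V).submatrix f f = HMat 0 W V := by
    ext x y
    simp only [Matrix.submatrix_apply, HMat, f, bcDiag_eq_degG b (hadj x x.2)]
    rfl
  have hH := HMat_isHermitian b A V
  rw [← hsub]
  exact ⟨evCount_submatrix_le hH hf E,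
    by simpa using evCount_le_evCount_submatrix_add hH hf E⟩

lemma evCount_VtxF_bounds (L : ℕ) (b : Fin 3) (V : ℝ × ℝ → ℝ) (E : ℝ) :
    evCount (HMat 0 (deepF L) V) E ≤ evCount (HMat b (VtxF L) V) E ∧
      evCount (HMat b (VtxF L) V) E ≤ evCount (HMat 0 (deepF L) V) E + 9 := by
  have h := evCount_HMat_bounds b ((deepF_subset_TruncF L).trans (TruncF_subset_VtxF L))
    (fun x hx y hy => TruncF_subset_VtxF L (mem_TruncF_of_adj hx hy)) V E
  have := card_VtxF_le L
  omega

lemma evCount_TruncF_bounds (L : ℕ) (b : Fin 3) (V : ℝ × ℝ → ℝ) (E : ℝ) :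
    evCount (HMat 0 (deepF L) V) E ≤ evCount (HMat b (TruncF L) V) E ∧
      evCount (HMat b (TruncF L) V) E ≤ evCount (HMat 0 (deepF L) V) E + 9 := by
  have h := evCount_HMat_bounds b (deepF_subset_TruncF L)
    (fun x hx y hy => mem_TruncF_of_adj hx hy) V E
  have := card_VtxF_le L
  have := Finset.card_le_card (TruncF_subset_VtxF L)
  omega

end SGL

open SGL

/-- For any two of the six operators
`H^{𝔾_L,S}, H^{𝔾_L,N}, H^{𝔾_L,D}, H^{G̃_L,S}, H^{G̃_L,N}, H^{G̃_L,D}`,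
the eigenvalue counting functions differ by at most `9`. -/
theorem counting_boundary_conditions (L : ℕ) (V : ℝ × ℝ → ℝ) (E : ℝ) :
    ∀ p ∈ [evCount (HMat 0 (VtxF L) V) E, evCount (HMat 1 (VtxF L) V) E,
           evCount (HMat 2 (VtxF L) V) E, evCount (HMat 0 (TruncF L) V) E,
           evCount (HMat 1 (TruncF L) V) E, evCount (HMat 2 (TruncF L) V) E],
    ∀ q ∈ [evCount (HMat 0 (VtxF L) V) E, evCount (HMat 1 (VtxF L) V) E,
           evCount (HMat 2 (VtxF L) V) E, evCount (HMat 0 (TruncF L) V) E,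
           evCount (HMat 1 (TruncF L) V) E, evCount (HMat 2 (TruncF L) V) E],
      |(p : ℤ) - (q : ℤ)| ≤ 9 := by
  have hb : ∀ p ∈ [evCount (HMat 0 (VtxF L) V) E, evCount (HMat 1 (VtxF L) V) E,
      evCount (HMat 2 (VtxF L) V) E, evCount (HMat 0 (TruncF L) V) E,
      evCount (HMat 1 (TruncF L) V) E, evCount (HMat 2 (TruncF L) V) E],
      evCount (HMat 0 (deepF L) V) E ≤ p ∧ p ≤ evCount (HMat 0 (deepF L) V) E + 9 := by
    simp only [List.forall_mem_cons, List.not_mem_nil, false_imp_iff, implies_true, and_true]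
    exact ⟨evCount_VtxF_bounds L 0 V E, evCount_VtxF_bounds L 1 V E,
      evCount_VtxF_bounds L 2 V E, evCount_TruncF_bounds L 0 V E,
      evCount_TruncF_bounds L 1 V E, evCount_TruncF_bounds L 2 V E⟩
  intro p hp q hq
  have h1 := hb p hp
  have h2 := hb q hq
  rw [abs_le]
  omega
end

section
/- Let β = log 5/log 2 and let G̃_ℓ be the truncated 2^ℓ-triangle obtained from 𝔾_ℓ by removing its three extreme vertices. The smallest eigenvalue E₀ of the simple-boundary Laplacian −Δ^{G̃_ℓ,S} on ℓ²(G̃_ℓ) satisfies 10·2^{−ℓβ} ≤ E₀ ≤ 40·2^{−ℓβ} for every ℓ ∈ ℕ. -/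
open scoped Classical

open SGL

namespace SGL

/-- Lattice coordinates of the lower-left corners of the unit triangles of `Tₙ`, described by
subdivision: a triangle splits into three of half the side, the one with both coordinates odd
being absent. -/
def IsBase : ℕ → ℤ × ℤ → Prop
  | 0, v => v = (0, 0)
  | n + 1, v => IsBase n (v.1 / 2, v.2 / 2) ∧ (v.1 % 2 = 0 ∨ v.2 % 2 = 0)

/-- Lattice coordinates of the non-extreme vertices of `𝔾ₙ`, described by subdivision. -/
def IsInterior : ℕ → ℤ × ℤ → Prop
  | 0, _ => False
  | n + 1, v =>
    if v.1 % 2 = 0 ∧ v.2 % 2 = 0 then IsInterior n (v.1 / 2, v.2 / 2)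
    else IsBase n (v.1 / 2, v.2 / 2)

/-- The point of the plane with given lattice coordinates. -/
noncomputable def emb (v : ℤ × ℤ) : ℝ × ℝ := ((v.1 : ℝ) + v.2 / 2, v.2 * (Real.sqrt 3 / 2))

/-- Lattice coordinates of the neighbours of `v` through the triangles of `Tₙ`. -/
noncomputable def nbr (n : ℕ) (v : ℤ × ℤ) : Finset (ℤ × ℤ) :=
  (if IsBase n v then {(v.1 + 1, v.2), (v.1, v.2 + 1)} else ∅) ∪
  (if IsBase n (v.1 - 1, v.2) then {(v.1 - 1, v.2), (v.1 - 1, v.2 + 1)} else ∅) ∪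
  (if IsBase n (v.1, v.2 - 1) then {(v.1, v.2 - 1), (v.1 + 1, v.2 - 1)} else ∅)

/-! ### Combinatorics of the lattice coordinates -/

theorem parity_cases (v : ℤ × ℤ) : ∃ p q : ℤ, v = (2 * p, 2 * q) ∨ v = (2 * p + 1, 2 * q) ∨
    v = (2 * p, 2 * q + 1) ∨ v = (2 * p + 1, 2 * q + 1) := by
  obtain ⟨i, j⟩ := v
  refine ⟨i / 2, j / 2, ?_⟩
  simp only [Prod.mk.injEq]
  omega

section Subdivision

variable (n : ℕ) (p q : ℤ)

theorem isBase_even_even : IsBase (n + 1) (2 * p, 2 * q) ↔ IsBase n (p, q) := by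
  simp [IsBase]

theorem isBase_odd_even : IsBase (n + 1) (2 * p + 1, 2 * q) ↔ IsBase n (p, q) := by
  have : (2 * p + 1) / 2 = p := by omega
  simp [IsBase, this]

theorem isBase_even_odd : IsBase (n + 1) (2 * p, 2 * q + 1) ↔ IsBase n (p, q) := by
  have : (2 * q + 1) / 2 = q := by omega
  simp [IsBase, this]

theorem not_isBase_odd_odd : ¬ IsBase (n + 1) (2 * p + 1, 2 * q + 1) := by
  rintro ⟨-, h⟩
  dsimp only at h
  omega

theorem isBase_left_even : IsBase (n + 1) (2 * p - 1, 2 * q) ↔ IsBase n (p - 1, q) := by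
  rw [show 2 * p - 1 = 2 * (p - 1) + 1 by ring, isBase_odd_even]

theorem isBase_even_left : IsBase (n + 1) (2 * p, 2 * q - 1) ↔ IsBase n (p, q - 1) := by
  rw [show 2 * q - 1 = 2 * (q - 1) + 1 by ring, isBase_even_odd]

theorem not_isBase_left_odd : ¬ IsBase (n + 1) (2 * p - 1, 2 * q + 1) := by
  rintro ⟨-, h⟩
  dsimp only at h
  omega

theorem not_isBase_odd_left : ¬ IsBase (n + 1) (2 * p + 1, 2 * q - 1) := by
  rintro ⟨-, h⟩
  dsimp only at h
  omega

theorem isInterior_even_even : IsInterior (n + 1) (2 * p, 2 * q) ↔ IsInterior n (p, q) := by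
  simp [IsInterior]

theorem isInterior_odd_even : IsInterior (n + 1) (2 * p + 1, 2 * q) ↔ IsBase n (p, q) := by
  have : (2 * p + 1) / 2 = p := by omega
  simp [IsInterior, this]

theorem isInterior_even_odd : IsInterior (n + 1) (2 * p, 2 * q + 1) ↔ IsBase n (p, q) := by
  have : (2 * q + 1) / 2 = q := by omega
  simp [IsInterior, this]

theorem isInterior_odd_odd : IsInterior (n + 1) (2 * p + 1, 2 * q + 1) ↔ IsBase n (p, q) := by
  have : (2 * q + 1) / 2 = q := by omega
  have : (2 * p + 1) / 2 = p := by omega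
  simp [IsInterior, *]

end Subdivision

theorem IsBase.nonneg {n : ℕ} : ∀ {v : ℤ × ℤ}, IsBase n v → 0 ≤ v.1 ∧ 0 ≤ v.2 := by
  induction n with
  | zero => rintro v rfl; simp
  | succ n ih =>
    rintro v ⟨h, -⟩
    have := ih h
    dsimp only at this
    omega

theorem IsBase.succ {n : ℕ} : ∀ {v : ℤ × ℤ}, IsBase n v → IsBase (n + 1) v := by
  induction n with
  | zero => rintro v rfl; simp [IsBase]
  | succ n ih => exact fun h => ⟨ih h.1, h.2⟩

theorem IsBase.mono {n m : ℕ} (hnm : n ≤ m) {v : ℤ × ℤ} (h : IsBase n v) : IsBase m v := by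
  induction hnm with
  | refl => exact h
  | step _ ih => exact ih.succ

theorem isBase_succ_iff (n : ℕ) : ∀ i j : ℤ, IsBase (n + 1) (i, j) ↔
    IsBase n (i, j) ∨ IsBase n (i - 2 ^ n, j) ∨ IsBase n (i, j - 2 ^ n) := by
  induction n with
  | zero =>
    intro i j
    simp only [IsBase, Prod.mk.injEq]
    omega
  | succ n ih =>
    intro i j
    have e (k : ℤ) : (k - 2 ^ (n + 1)) / 2 = k / 2 - 2 ^ n := by rw [pow_succ]; omega
    have e' (k : ℤ) : (k - 2 ^ (n + 1)) % 2 = k % 2 := by rw [pow_succ]; omega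
    rw [IsBase, ih]
    simp only [IsBase, e, e']
    tauto

theorem IsInterior.nonneg {n : ℕ} : ∀ {v : ℤ × ℤ}, IsInterior n v →
    0 ≤ v.1 ∧ 0 ≤ v.2 ∧ 0 < v.1 + v.2 := by
  induction n with
  | zero => exact fun h => h.elim
  | succ n ih =>
    intro v h
    rw [IsInterior] at h
    split_ifs at h with hv
    · have := ih h
      dsimp only at this
      omega
    · have := h.nonneg
      dsimp only at this
      omega

/-- A non-extreme vertex of `𝔾ₙ` lies in exactly two of the unit triangles, both in `Tₙ`. -/
theorem IsInterior.isBase_cases {n m : ℕ} (hnm : n ≤ m) : ∀ {v : ℤ × ℤ}, IsInterior n v →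
    (IsBase n v ∧ IsBase n (v.1 - 1, v.2) ∧ ¬ IsBase m (v.1, v.2 - 1)) ∨
    (IsBase n v ∧ ¬ IsBase m (v.1 - 1, v.2) ∧ IsBase n (v.1, v.2 - 1)) ∨
    (¬ IsBase m v ∧ IsBase n (v.1 - 1, v.2) ∧ IsBase n (v.1, v.2 - 1)) := by
  induction n generalizing m with
  | zero => exact fun h => h.elim
  | succ n ih =>
    intro v h
    obtain ⟨m, rfl⟩ : ∃ k, m = k + 1 := ⟨m - 1, by omega⟩
    obtain ⟨p, q, rfl | rfl | rfl | rfl⟩ := parity_cases v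
    · have := ih (m := m) (by omega) ((isInterior_even_even n p q).1 h)
      simpa only [isBase_even_even, isBase_left_even, isBase_even_left] using this
    · left
      have := (isInterior_odd_even n p q).1 h
      simp only [add_sub_cancel_right]
      exact ⟨(isBase_odd_even n p q).2 this, (isBase_even_even n p q).2 this,
        not_isBase_odd_left m p q⟩
    · right; left
      have := (isInterior_even_odd n p q).1 h
      simp only [add_sub_cancel_right]
      exact ⟨(isBase_even_odd n p q).2 this, not_isBase_left_odd m p q,
        (isBase_even_even n p q).2 this⟩
    · right; right
      have := (isInterior_odd_odd n p q).1 h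
      simp only [add_sub_cancel_right]
      exact ⟨not_isBase_odd_odd m p q, (isBase_even_odd n p q).2 this,
        (isBase_odd_even n p q).2 this⟩

/-- The non-extreme vertices are the vertices of the unit triangles other than the corners. -/
theorem isInterior_iff (n : ℕ) : ∀ v : ℤ × ℤ, IsInterior n v ↔
    (IsBase n v ∨ IsBase n (v.1 - 1, v.2) ∨ IsBase n (v.1, v.2 - 1)) ∧
      v ≠ (0, 0) ∧ v ≠ (2 ^ n, 0) ∧ v ≠ (0, 2 ^ n) := by
  induction n with
  | zero =>
    rintro ⟨i, j⟩
    simp only [IsInterior, IsBase, ne_eq, Prod.mk.injEq, false_iff]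
    omega
  | succ n ih =>
    intro v
    obtain ⟨p, q, rfl | rfl | rfl | rfl⟩ := parity_cases v
    · rw [isInterior_even_even, ih]
      simp only [isBase_even_even, isBase_left_even, isBase_even_left, ne_eq, Prod.mk.injEq]
      have : (2 : ℤ) ^ (n + 1) = 2 * 2 ^ n := by ring
      rw [this]
      refine and_congr_right fun _ => ?_
      omega
    · rw [isInterior_odd_even]
      simp only [add_sub_cancel_right, isBase_odd_even, isBase_even_even, not_isBase_odd_left,
        ne_eq, Prod.mk.injEq]
      have : (2 : ℤ) ^ (n + 1) = 2 * 2 ^ n := by ring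
      have h : ¬ (2 * p + 1 = 2 ^ (n + 1)) := by omega
      have h' : ¬ (2 * p + 1 = 0) := by omega
      tauto
    · rw [isInterior_even_odd]
      simp only [add_sub_cancel_right, isBase_even_odd, isBase_even_even, not_isBase_left_odd,
        ne_eq, Prod.mk.injEq]
      have : (2 : ℤ) ^ (n + 1) = 2 * 2 ^ n := by ring
      have h : ¬ (2 * q + 1 = 2 ^ (n + 1)) := by omega
      have h' : ¬ (2 * q + 1 = 0) := by omega
      tauto
    · rw [isInterior_odd_odd]
      simp only [add_sub_cancel_right, isBase_even_odd, isBase_odd_even, not_isBase_odd_odd,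
        ne_eq, Prod.mk.injEq]
      have h : ¬ (2 * p + 1 = 0) := by omega
      have h' : ¬ (2 * q + 1 = 0) := by omega
      tauto

/-- Every unit triangle of `T_{n+1}` has a non-extreme vertex. -/
theorem IsBase.exists_isInterior {n : ℕ} {v : ℤ × ℤ} (h : IsBase (n + 1) v) :
    IsInterior (n + 1) v ∨ IsInterior (n + 1) (v.1 + 1, v.2) := by
  obtain ⟨p, q, rfl | rfl | rfl | rfl⟩ := parity_cases v
  · exact .inr ((isInterior_odd_even n p q).2 ((isBase_even_even n p q).1 h))
  · exact .inl ((isInterior_odd_even n p q).2 ((isBase_odd_even n p q).1 h))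
  · exact .inl ((isInterior_even_odd n p q).2 ((isBase_even_odd n p q).1 h))
  · exact (not_isBase_odd_odd n p q h).elim

theorem IsInterior.card_nbr {n : ℕ} {v : ℤ × ℤ} (h : IsInterior n v) : (nbr n v).card = 4 := by
  obtain ⟨i, j⟩ := v
  rcases h.isBase_cases le_rfl with ⟨h1, h2, h3⟩ | ⟨h1, h2, h3⟩ | ⟨h1, h2, h3⟩ <;>
  · dsimp only at h1 h2 h3
    simp only [nbr, h1, h2, h3, if_true, if_false, Finset.union_empty, Finset.empty_union]
    rw [Finset.card_union_of_disjoint (by simp; omega), Finset.card_pair (by simp),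
      Finset.card_pair (by simp)]

theorem IsInterior.sum_nbr {n : ℕ} {v : ℤ × ℤ} (h : IsInterior n v) (F : ℤ × ℤ → ℝ) :
    ∑ u ∈ nbr n v, F u =
      (if IsBase n v then F (v.1 + 1, v.2) + F (v.1, v.2 + 1) else 0) +
      (if IsBase n (v.1 - 1, v.2) then F (v.1 - 1, v.2) + F (v.1 - 1, v.2 + 1) else 0) +
      (if IsBase n (v.1, v.2 - 1) then F (v.1, v.2 - 1) + F (v.1 + 1, v.2 - 1) else 0) := by
  obtain ⟨i, j⟩ := v
  rcases h.isBase_cases le_rfl with ⟨h1, h2, h3⟩ | ⟨h1, h2, h3⟩ | ⟨h1, h2, h3⟩ <;>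
  · dsimp only at h1 h2 h3
    simp only [nbr, h1, h2, h3, if_true, if_false, Finset.union_empty, Finset.empty_union]
    rw [Finset.sum_union (by simp; omega), Finset.sum_pair (by simp),
      Finset.sum_pair (by simp)]
    ring

/-! ### Spectral decimation -/

/-- The ground state energy of the truncated triangle of side `2 ^ (k + 1)`. -/
noncomputable def energy : ℕ → ℝ
  | 0 => 2
  | k + 1 => (5 - Real.sqrt (25 - 4 * energy k)) / 2

theorem energy_succ_aux {y : ℝ} (h0 : 0 < y) (h2 : y ≤ 2) :
    0 < (5 - Real.sqrt (25 - 4 * y)) / 2 ∧ (5 - Real.sqrt (25 - 4 * y)) / 2 < 1 ∧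
    (5 - Real.sqrt (25 - 4 * y)) / 2 * (5 - (5 - Real.sqrt (25 - 4 * y)) / 2) = y := by
  have hs := Real.sq_sqrt (show (0 : ℝ) ≤ 25 - 4 * y by linarith)
  have hn := Real.sqrt_nonneg (25 - 4 * y)
  refine ⟨?_, ?_, ?_⟩ <;> nlinarith

theorem energy_mem (k : ℕ) : 0 < energy k ∧ energy k ≤ 2 := by
  induction k with
  | zero => simp [energy]
  | succ k ih =>
    have := energy_succ_aux ih.1 ih.2
    exact ⟨this.1, by rw [energy]; linarith⟩

theorem energy_succ_lt_one (k : ℕ) : energy (k + 1) < 1 :=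
  (energy_succ_aux (energy_mem k).1 (energy_mem k).2).2.1

theorem energy_succ_mul (k : ℕ) : energy (k + 1) * (5 - energy (k + 1)) = energy k :=
  (energy_succ_aux (energy_mem k).1 (energy_mem k).2).2.2

theorem le_energy_mul_pow (k : ℕ) : 2 ≤ energy k * 5 ^ k := by
  induction k with
  | zero => simp [energy]
  | succ k ih =>
    have h := energy_succ_mul k
    have h0 := (energy_mem (k + 1)).1
    have : energy k ≤ 5 * energy (k + 1) := by nlinarith
    calc (2 : ℝ) ≤ energy k * 5 ^ k := ih
      _ ≤ 5 * energy (k + 1) * 5 ^ k := by gcongr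
      _ = energy (k + 1) * 5 ^ (k + 1) := by ring

theorem energy_mul_pow_le (k : ℕ) : energy k * 5 ^ k ≤ 4 - energy k := by
  induction k with
  | zero => norm_num [energy]
  | succ k ih =>
    have h0 := (energy_mem (k + 1)).1
    have h1 := energy_succ_lt_one k
    rw [← energy_succ_mul k] at ih
    set x := energy (k + 1)
    rw [pow_succ]
    refine le_of_mul_le_mul_right ?_ (show (0 : ℝ) < 5 - x by linarith)
    nlinarith [mul_pos h0 (show (0 : ℝ) < 4 - x by linarith)]

/-- The ground state of the truncated triangle of side `2 ^ (k + 1)`, in lattice coordinates and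
extended by zero. -/
noncomputable def groundState : ℕ → ℤ × ℤ → ℝ
  | 0, v => if IsInterior 1 v then 1 else 0
  | k + 1, v =>
    if v.1 % 2 = 0 ∧ v.2 % 2 = 0 then groundState k (v.1 / 2, v.2 / 2)
    else if IsBase (k + 1) (v.1 / 2, v.2 / 2) then
      (2 * (groundState k (v.1 / 2, v.2 / 2) + groundState k (v.1 / 2 + 1, v.2 / 2)
          + groundState k (v.1 / 2, v.2 / 2 + 1))
        + (2 - energy (k + 1)) *
          (if v.2 % 2 = 0 then
            groundState k (v.1 / 2, v.2 / 2) + groundState k (v.1 / 2 + 1, v.2 / 2)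
          else if v.1 % 2 = 0 then
            groundState k (v.1 / 2, v.2 / 2) + groundState k (v.1 / 2, v.2 / 2 + 1)
          else groundState k (v.1 / 2 + 1, v.2 / 2) + groundState k (v.1 / 2, v.2 / 2 + 1)))
        / ((2 - energy (k + 1)) * (5 - energy (k + 1)))
    else 0

theorem groundState_even_even (k : ℕ) (p q : ℤ) :
    groundState (k + 1) (2 * p, 2 * q) = groundState k (p, q) := by
  simp [groundState]

section Midpoints

variable {k : ℕ} {p q : ℤ}

theorem groundState_odd_even (h : IsBase (k + 1) (p, q)) :
    groundState (k + 1) (2 * p + 1, 2 * q) =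
    (2 * (groundState k (p, q) + groundState k (p + 1, q) + groundState k (p, q + 1))
        + (2 - energy (k + 1)) * (groundState k (p, q) + groundState k (p + 1, q)))
      / ((2 - energy (k + 1)) * (5 - energy (k + 1))) := by
  have : (2 * p + 1) / 2 = p := by omega
  simp [groundState, this, h]

theorem groundState_even_odd (h : IsBase (k + 1) (p, q)) :
    groundState (k + 1) (2 * p, 2 * q + 1) =
    (2 * (groundState k (p, q) + groundState k (p + 1, q) + groundState k (p, q + 1))
        + (2 - energy (k + 1)) * (groundState k (p, q) + groundState k (p, q + 1)))
      / ((2 - energy (k + 1)) * (5 - energy (k + 1))) := by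
  have : (2 * q + 1) / 2 = q := by omega
  simp [groundState, this, h]

theorem groundState_odd_odd (h : IsBase (k + 1) (p, q)) :
    groundState (k + 1) (2 * p + 1, 2 * q + 1) =
    (2 * (groundState k (p, q) + groundState k (p + 1, q) + groundState k (p, q + 1))
        + (2 - energy (k + 1)) * (groundState k (p + 1, q) + groundState k (p, q + 1)))
      / ((2 - energy (k + 1)) * (5 - energy (k + 1))) := by
  have : (2 * q + 1) / 2 = q := by omega
  have : (2 * p + 1) / 2 = p := by omega
  simp [groundState, *]

end Midpoints

theorem groundState_eq_zero {k : ℕ} : ∀ {v : ℤ × ℤ}, ¬ IsInterior (k + 1) v →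
    groundState k v = 0 := by
  induction k with
  | zero => intro v h; simp only [groundState]; exact if_neg h
  | succ k ih =>
    intro v h
    rw [IsInterior] at h
    rw [groundState]
    split_ifs at h ⊢ with hv
    · exact ih h
    · rfl

theorem groundState_pos {k : ℕ} : ∀ {v : ℤ × ℤ}, IsInterior (k + 1) v →
    0 < groundState k v := by
  induction k with
  | zero => intro v h; simp only [groundState]; rw [if_pos h]; exact one_pos
  | succ k ih =>
    intro v h
    have nn (u : ℤ × ℤ) : 0 ≤ groundState k u := by
      by_cases hu : IsInterior (k + 1) u
      · exact (ih hu).le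
      · exact (groundState_eq_zero hu).ge
    have hE := energy_succ_lt_one k
    rw [IsInterior] at h
    rw [groundState]
    split_ifs at h ⊢ with hv
    · exact ih h
    all_goals
      have hs : 0 < groundState k (v.1 / 2, v.2 / 2) + groundState k (v.1 / 2 + 1, v.2 / 2) := by
        rcases h.exists_isInterior with h | h
        · exact add_pos_of_pos_of_nonneg (ih h) (nn _)
        · exact add_pos_of_nonneg_of_pos (nn _) (ih h)
      have h1 := nn (v.1 / 2, v.2 / 2)
      have h2 := nn (v.1 / 2 + 1, v.2 / 2)
      have h3 := nn (v.1 / 2, v.2 / 2 + 1)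
      have hE' : 0 < 2 - energy (k + 1) := by linarith
      have hE'' : 0 < 5 - energy (k + 1) := by linarith
      refine div_pos (add_pos_of_pos_of_nonneg ?_ ?_) (by positivity)
      · linarith
      · positivity

/-- The eigenvalue equation for the ground state. -/
theorem sum_nbr_groundState {k : ℕ} : ∀ {v : ℤ × ℤ}, IsInterior (k + 1) v →
    ∑ u ∈ nbr (k + 1) v, groundState k u = (4 - energy k) * groundState k v := by
  induction k with
  | zero =>
    rintro v h
    rw [h.sum_nbr]
    obtain ⟨p, q, rfl | rfl | rfl | rfl⟩ := parity_cases v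
    · exact ((isInterior_even_even 0 p q).1 h).elim
    · obtain ⟨rfl, rfl⟩ := Prod.mk.inj ((isInterior_odd_even 0 p q).1 h)
      norm_num [IsBase, IsInterior, groundState, energy]
    · obtain ⟨rfl, rfl⟩ := Prod.mk.inj ((isInterior_even_odd 0 p q).1 h)
      norm_num [IsBase, IsInterior, groundState, energy]
    · obtain ⟨rfl, rfl⟩ := Prod.mk.inj ((isInterior_odd_odd 0 p q).1 h)
      norm_num [IsBase, IsInterior, groundState, energy]
  | succ k ih =>
    intro v h
    have hE := energy_succ_lt_one k
    have hE' : 2 - energy (k + 1) ≠ 0 := by linarith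
    have hE'' : 5 - energy (k + 1) ≠ 0 := by linarith
    have hE3 := energy_succ_mul k
    rw [h.sum_nbr]
    obtain ⟨p, q, rfl | rfl | rfl | rfl⟩ := parity_cases v
    · rw [isInterior_even_even] at h
      have hs := ih h
      rw [h.sum_nbr, ← hE3] at hs
      have ep : 2 * p - 1 = 2 * (p - 1) + 1 := by ring
      have eq : 2 * q - 1 = 2 * (q - 1) + 1 := by ring
      simp only [isBase_even_even, isBase_left_even, isBase_even_left, groundState_even_even]
      rw [ep, eq]
      rcases h.isBase_cases le_rfl with ⟨h1, h2, h3⟩ | ⟨h1, h2, h3⟩ | ⟨h1, h2, h3⟩ <;>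
      · dsimp only at h1 h2 h3 hs
        simp only [h1, h2, h3, if_true, if_false, groundState_odd_even,
          groundState_even_odd, groundState_odd_odd, sub_add_cancel, add_zero, zero_add] at hs ⊢
        field_simp
        linear_combination (6 - energy (k + 1)) * hs
    · have hb := (isInterior_odd_even (k + 1) p q).1 h
      have e : 2 * p + 1 + 1 = 2 * (p + 1) := by ring
      simp only [add_sub_cancel_right, isBase_odd_even, isBase_even_even, not_isBase_odd_left,
        hb, if_true, if_false, e, groundState_even_even, groundState_odd_even,
        groundState_even_odd, groundState_odd_odd]
      field_simp
      ring
    · have hb := (isInterior_even_odd (k + 1) p q).1 h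
      have e : 2 * q + 1 + 1 = 2 * (q + 1) := by ring
      simp only [add_sub_cancel_right, isBase_even_odd, isBase_even_even, not_isBase_left_odd,
        hb, if_true, if_false, e, groundState_even_even, groundState_odd_even,
        groundState_even_odd, groundState_odd_odd]
      field_simp
      ring
    · have hb := (isInterior_odd_odd (k + 1) p q).1 h
      have ep : 2 * p + 1 + 1 = 2 * (p + 1) := by ring
      have eq : 2 * q + 1 + 1 = 2 * (q + 1) := by ring
      simp only [add_sub_cancel_right, isBase_even_odd, isBase_odd_even, not_isBase_odd_odd,
        hb, if_true, if_false, ep, eq, groundState_even_even, groundState_odd_even,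
        groundState_even_odd, groundState_odd_odd]
      field_simp
      ring

/-! ### Comparison with the planar lattice -/

theorem emb_injective : Function.Injective emb := by
  rintro ⟨i, j⟩ ⟨i', j'⟩ h
  obtain ⟨h1, h2⟩ := Prod.mk.inj h
  have h3 : Real.sqrt 3 / 2 ≠ 0 := by positivity
  have hj : (j : ℝ) = j' := mul_right_cancel₀ h3 h2
  dsimp only at h1
  have hi : (i : ℝ) = i' := by rw [hj] at h1; linarith
  exact Prod.ext (by exact_mod_cast hi) (by exact_mod_cast hj)

theorem emb_add_smul_a2 (v : ℤ × ℤ) (m : ℤ) : emb v + (m : ℝ) • a2 = emb (v.1 + m, v.2) := by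
  ext <;> simp [emb, a2]
  ring

theorem emb_add_smul_a3 (v : ℤ × ℤ) (m : ℤ) : emb v + (m : ℝ) • a3 = emb (v.1, v.2 + m) := by
  ext <;> simp [emb, a3] <;> ring

theorem mem_baseSet (n : ℕ) : ∀ {t : ℝ × ℝ}, t ∈ baseSet n ↔ ∃ v, IsBase n v ∧ emb v = t := by
  induction n with
  | zero =>
    intro t
    simp [baseSet, IsBase, emb, eq_comm]
  | succ n ih =>
    intro t
    have e2 (v : ℤ × ℤ) : emb v + (2 ^ n : ℝ) • a2 = emb (v.1 + 2 ^ n, v.2) := by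
      rw [← emb_add_smul_a2]; push_cast; rfl
    have e3 (v : ℤ × ℤ) : emb v + (2 ^ n : ℝ) • a3 = emb (v.1, v.2 + 2 ^ n) := by
      rw [← emb_add_smul_a3]; push_cast; rfl
    simp only [baseSet, Finset.mem_union, Finset.mem_image, ih]
    constructor
    · rintro ((⟨v, hv, rfl⟩ | ⟨_, ⟨v, hv, rfl⟩, rfl⟩) | ⟨_, ⟨v, hv, rfl⟩, rfl⟩)
      · exact ⟨v, hv.succ, rfl⟩
      · refine ⟨_, ?_, (e2 v).symm⟩
        rw [isBase_succ_iff]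
        simp [hv]
      · refine ⟨_, ?_, (e3 v).symm⟩
        rw [isBase_succ_iff]
        simp [hv]
    · rintro ⟨⟨i, j⟩, hv, rfl⟩
      rcases (isBase_succ_iff n i j).1 hv with h | h | h
      · exact .inl (.inl ⟨_, h, rfl⟩)
      · refine .inl (.inr ⟨_, ⟨_, h, rfl⟩, ?_⟩)
        simp [e2]
      · refine .inr ⟨_, ⟨_, h, rfl⟩, ?_⟩
        simp [e3]

theorem mem_tri_emb {x : ℝ × ℝ} {t : ℤ × ℤ} : x ∈ tri (emb t) ↔
    x = emb t ∨ x = emb (t.1 + 1, t.2) ∨ x = emb (t.1, t.2 + 1) := by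
  have h2 := emb_add_smul_a2 t 1
  have h3 := emb_add_smul_a3 t 1
  simp only [Int.cast_one, one_smul] at h2 h3
  simp [tri, h2, h3]

theorem emb_mem_TruncF {n : ℕ} {v : ℤ × ℤ} : emb v ∈ TruncF n ↔ IsInterior n v := by
  have h1 : ((0, 0) : ℝ × ℝ) = emb (0, 0) := by simp [emb]
  have h2 : (2 ^ n : ℝ) • a2 = emb (2 ^ n, 0) := by ext <;> simp [emb, a2]
  have h3 : (2 ^ n : ℝ) • a3 = emb (0, 2 ^ n) := by
    ext <;> simp [emb, a3]
    ring
  rw [isInterior_iff, TruncF, cornerF, h1, h2, h3]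
  simp only [Finset.mem_sdiff, Finset.mem_insert, Finset.mem_singleton, emb_injective.eq_iff,
    VtxF, Finset.mem_biUnion, mem_baseSet, not_or, ne_eq]
  refine and_congr_left fun _ => ⟨?_, ?_⟩
  · rintro ⟨_, ⟨t, ht, rfl⟩, hv⟩
    rw [mem_tri_emb] at hv
    simp only [emb_injective.eq_iff] at hv
    rcases hv with rfl | rfl | rfl <;> simp [ht]
  · rintro (h | h | h)
    · exact ⟨_, ⟨_, h, rfl⟩, mem_tri_emb.2 (.inl rfl)⟩
    · exact ⟨_, ⟨_, h, rfl⟩, mem_tri_emb.2 (.inr (.inl (by simp)))⟩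
    · exact ⟨_, ⟨_, h, rfl⟩, mem_tri_emb.2 (.inr (.inr (by simp)))⟩

theorem exists_of_mem_TruncF {n : ℕ} {x : ℝ × ℝ} (h : x ∈ TruncF n) :
    ∃ v, IsInterior n v ∧ emb v = x := by
  have h' := (Finset.mem_sdiff.1 h).1
  simp only [VtxF, Finset.mem_biUnion, mem_baseSet] at h'
  obtain ⟨_, ⟨t, ht, rfl⟩, hx⟩ := h'
  obtain ⟨v, rfl⟩ : ∃ v, emb v = x := by
    rcases mem_tri_emb.1 hx with rfl | rfl | rfl <;> exact ⟨_, rfl⟩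
  exact ⟨v, emb_mem_TruncF.1 h, rfl⟩

theorem edgeIn_emb_iff {n : ℕ} {v : ℤ × ℤ} {y : ℝ × ℝ} :
    EdgeIn n (emb v) y ↔ ∃ u ∈ nbr n v, emb u = y := by
  obtain ⟨i, j⟩ := v
  constructor
  · rintro ⟨_, ht, hx, hy, hne⟩
    obtain ⟨t, hb, rfl⟩ := (mem_baseSet n).1 ht
    rw [mem_tri_emb] at hx hy
    simp only [emb_injective.eq_iff] at hx
    obtain ⟨a, b⟩ := t
    rcases hx with hx | hx | hx <;> obtain ⟨rfl, rfl⟩ := Prod.mk.inj hx <;>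
      rcases hy with rfl | rfl | rfl <;>
      first
      | exact absurd rfl hne
      | refine ⟨_, ?_, rfl⟩; simp [nbr, hb]
  · rintro ⟨u, hu, rfl⟩
    have key (t : ℤ × ℤ) (ht : IsBase n t) (hv : (i, j) = t ∨ (i, j) = (t.1 + 1, t.2) ∨
        (i, j) = (t.1, t.2 + 1)) (hu : u = t ∨ u = (t.1 + 1, t.2) ∨ u = (t.1, t.2 + 1))
        (hne : (i, j) ≠ u) : EdgeIn n (emb (i, j)) (emb u) := by
      refine ⟨emb t, (mem_baseSet n).2 ⟨t, ht, rfl⟩, ?_, ?_, emb_injective.ne hne⟩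
      · rw [mem_tri_emb]; simpa only [emb_injective.eq_iff] using hv
      · rw [mem_tri_emb]; simpa only [emb_injective.eq_iff] using hu
    simp only [nbr, Finset.mem_union] at hu
    rcases hu with (hu | hu) | hu <;> split_ifs at hu with h <;>
      simp only [Finset.mem_insert, Finset.mem_singleton, Finset.notMem_empty] at hu <;>
      rcases hu with rfl | rfl <;>
      exact key _ h (by simp) (by simp) (by simp <;> omega)

theorem IsInterior.nbr_eq {n m : ℕ} (hnm : n ≤ m) {v : ℤ × ℤ} (h : IsInterior n v) :
    nbr m v = nbr n v := by
  have key (t : ℤ × ℤ) (ht : IsBase n t ∨ ¬ IsBase m t) : IsBase m t ↔ IsBase n t :=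
    ⟨fun h => ht.resolve_right (not_not.2 h), IsBase.mono hnm⟩
  have := h.isBase_cases hnm
  rw [nbr, nbr]
  simp only [key v (by tauto), key (v.1 - 1, v.2) (by tauto), key (v.1, v.2 - 1) (by tauto)]

theorem IsInterior.adj_iff {n : ℕ} {v : ℤ × ℤ} (h : IsInterior n v) {y : ℝ × ℝ} :
    Adj (emb v) y ↔ ∃ u ∈ nbr n v, emb u = y := by
  constructor
  · rintro (⟨m, hm⟩ | ⟨m, t, ht, hx, -⟩)
    · have hm' : ∃ u ∈ nbr (max n m) v, emb u = y := by
        obtain ⟨t, ht, hxy⟩ := hm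
        obtain ⟨w, hw, rfl⟩ := (mem_baseSet m).1 ht
        exact edgeIn_emb_iff.1
          ⟨_, (mem_baseSet _).2 ⟨w, hw.mono (le_max_right n m), rfl⟩, hxy⟩
      rwa [h.nbr_eq (le_max_left n m)] at hm'
    · exfalso
      obtain ⟨w, hw, rfl⟩ := (mem_baseSet m).1 ht
      have hpos (i j : ℤ) (hi : 0 ≤ i) (hj : 0 ≤ j) : 0 ≤ (emb (i, j)).1 := by
        have : (0 : ℝ) ≤ i := by exact_mod_cast hi
        have : (0 : ℝ) ≤ j := by exact_mod_cast hj
        simp only [emb]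
        positivity
      have hw0 := hw.nonneg
      have h1 : 0 ≤ (reflY (emb v)).1 := by
        rcases mem_tri_emb.1 hx with h | h | h <;> rw [h] <;> apply hpos <;> omega
      have hv := h.nonneg
      have h2 : (0 : ℝ) ≤ v.1 := by exact_mod_cast hv.1
      have h3 : (0 : ℝ) ≤ v.2 := by exact_mod_cast hv.2.1
      have h4 : (0 : ℝ) < v.1 + v.2 := by exact_mod_cast hv.2.2
      simp only [reflY, emb] at h1
      linarith
  · exact fun hu => .inl ⟨n, edgeIn_emb_iff.2 hu⟩

theorem IsInterior.degG_eq {n : ℕ} {v : ℤ × ℤ} (h : IsInterior n v) : degG (emb v) = 4 := by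
  have : {y | Adj (emb v) y} = (((nbr n v).image emb : Finset (ℝ × ℝ)) : Set (ℝ × ℝ)) := by
    ext y
    simp [h.adj_iff]
  rw [degG, this, Set.ncard_coe_finset, Finset.card_image_of_injective _ emb_injective,
    h.card_nbr]

/-- The action of the simple-boundary Laplacian on a function given in lattice coordinates that
vanishes off the truncated triangle. -/
theorem mulVec_HMat_emb {n : ℕ} {F : ℤ × ℤ → ℝ} (hF : ∀ v, ¬ IsInterior n v → F v = 0)
    {v : ℤ × ℤ} (hv : emb v ∈ TruncF n) :
    (HMat 0 (TruncF n) fun _ => 0).mulVec (fun y => Function.extend emb F 0 y) ⟨emb v, hv⟩ =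
      4 * F v - ∑ u ∈ nbr n v, F u := by
  have h := emb_mem_TruncF.1 hv
  set G := Function.extend emb F 0
  have hG (u : ℤ × ℤ) : G (emb u) = F u := emb_injective.extend_apply F 0 u
  have hadj : ∑ y : TruncF n, (if Adj (emb v) y then G y else 0) = ∑ u ∈ nbr n v, F u := by
    rw [Finset.sum_coe_sort (TruncF n) fun y => if Adj (emb v) y then G y else 0,
      ← Finset.sum_filter]
    have hsub : (TruncF n).filter (fun y => Adj (emb v) y) ⊆ (nbr n v).image emb := by
      intro y hy
      simpa [h.adj_iff] using (Finset.mem_filter.1 hy).2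
    rw [Finset.sum_subset hsub, Finset.sum_image emb_injective.injOn]
    · simp only [hG]
    · intro y hy hy'
      obtain ⟨u, hu, rfl⟩ := Finset.mem_image.1 hy
      rw [hG]
      refine hF u fun hi => hy' (Finset.mem_filter.2 ⟨emb_mem_TruncF.2 hi, ?_⟩)
      exact h.adj_iff.2 ⟨u, hu, rfl⟩
  have hdiag : ∑ y : TruncF n, (if emb v = y then 4 * G y else 0) = 4 * F v := by
    rw [Finset.sum_coe_sort (TruncF n) fun y => if emb v = y then 4 * G y else 0,
      Finset.sum_ite_eq, if_pos hv, hG]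
  rw [← hadj, ← hdiag, ← Finset.sum_sub_distrib]
  refine Finset.sum_congr rfl fun y _ => ?_
  simp only [HMat, bcDiag, h.degG_eq, sub_mul, ite_mul]
  norm_num

/-- A positive eigenvector of a matrix with nonpositive off-diagonal entries belongs to the
smallest eigenvalue. -/
theorem le_of_hasEigenvalue_of_pos {ι : Type*} [Fintype ι] [DecidableEq ι] {M : Matrix ι ι ℝ}
    (hM : ∀ i j, i ≠ j → M i j ≤ 0) {f : ι → ℝ} (hf : ∀ i, 0 < f i) {E : ℝ}
    (hE : M.mulVec f = E • f) {μ : ℝ} (hμ : Module.End.HasEigenvalue M.mulVecLin μ) :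
    E ≤ μ := by
  obtain ⟨g, hg⟩ := hμ.exists_hasEigenvector
  have hgμ : M.mulVec g = μ • g := hg.apply_eq_smul
  obtain ⟨i₀, hi₀⟩ := Function.ne_iff.1 hg.2
  obtain ⟨i, -, hi⟩ := Finset.exists_max_image Finset.univ (fun i => |g i| / f i)
    ⟨i₀, Finset.mem_univ _⟩
  set c := |g i| / f i
  have hc : 0 < c := lt_of_lt_of_le (div_pos (abs_pos.2 hi₀) (hf i₀)) (hi i₀ (Finset.mem_univ _))
  have hle (j : ι) : |g j| ≤ c * f j := (div_le_iff₀ (hf j)).1 (hi j (Finset.mem_univ _))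
  have heq : |g i| = c * f i := (div_mul_cancel₀ _ (hf i).ne').symm
  have h1 : M i i * f i + ∑ j ∈ Finset.univ.erase i, M i j * f j = E * f i := by
    rw [Finset.add_sum_erase Finset.univ (fun j => M i j * f j) (Finset.mem_univ i)]
    exact congrFun hE i
  have h2 : M i i * g i + ∑ j ∈ Finset.univ.erase i, M i j * g j = μ * g i := by
    rw [Finset.add_sum_erase Finset.univ (fun j => M i j * g j) (Finset.mem_univ i)]
    exact congrFun hgμ i
  have h3 : (M i i - μ) * |g i| ≤ (M i i - E) * |g i| := by
    calc (M i i - μ) * |g i| ≤ |(M i i - μ) * g i| := by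
          rw [abs_mul]
          gcongr
          exact le_abs_self _
      _ = |∑ j ∈ Finset.univ.erase i, M i j * g j| := by
          rw [← abs_neg]
          congr 1
          linarith
      _ ≤ ∑ j ∈ Finset.univ.erase i, |M i j * g j| := Finset.abs_sum_le_sum_abs _ _
      _ ≤ ∑ j ∈ Finset.univ.erase i, -c * (M i j * f j) := by
          refine Finset.sum_le_sum fun j hj => ?_
          have := hM i j (Finset.ne_of_mem_erase hj).symm
          rw [abs_mul, abs_of_nonpos this]
          nlinarith [hle j]
      _ = (M i i - E) * |g i| := by
          rw [← Finset.mul_sum, heq]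
          linear_combination -c * h1
  have : 0 < |g i| := heq ▸ mul_pos hc (hf i)
  linarith [le_of_mul_le_mul_right h3 this]

end SGL

/-- For `β = log 5 / log 2`, the smallest eigenvalue `E₀` of the
simple-boundary (zero Dirichlet) Laplacian `−Δ^{G̃_ℓ,S}` on the truncated triangle `G̃_ℓ`
satisfies `10·2^{−ℓβ} ≤ E₀ ≤ 40·2^{−ℓβ}`. -/
theorem simple_laplacian_ground_state (ℓ : ℕ) (hℓ : 1 ≤ ℓ) :
    ∃ E₀ : ℝ,
      Module.End.HasEigenvalue
        (Matrix.mulVecLin (HMat 0 (TruncF ℓ) (fun _ => 0))) E₀ ∧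
      (∀ μ : ℝ, Module.End.HasEigenvalue
          (Matrix.mulVecLin (HMat 0 (TruncF ℓ) (fun _ => 0))) μ → E₀ ≤ μ) ∧
      10 * (2 : ℝ) ^ (-(ℓ : ℝ) * (Real.log 5 / Real.log 2)) ≤ E₀ ∧
      E₀ ≤ 40 * (2 : ℝ) ^ (-(ℓ : ℝ) * (Real.log 5 / Real.log 2)) := by
  obtain ⟨k, rfl⟩ : ∃ k, ℓ = k + 1 := ⟨ℓ - 1, by omega⟩
  have hpow : (2 : ℝ) ^ (-((k + 1 : ℕ) : ℝ) * (Real.log 5 / Real.log 2)) = 1 / 5 ^ (k + 1) := by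
    have h2 : Real.log 2 ≠ 0 := (Real.log_pos (by norm_num)).ne'
    rw [Real.rpow_def_of_pos two_pos,
      show Real.log 2 * (-((k + 1 : ℕ) : ℝ) * (Real.log 5 / Real.log 2)) =
        -((k + 1 : ℕ) * Real.log 5) by field_simp,
      Real.exp_neg, Real.exp_nat_mul, Real.exp_log (by norm_num), one_div]
  set f : TruncF (k + 1) → ℝ := fun y => Function.extend emb (groundState k) 0 y
  have hpos (x : TruncF (k + 1)) : 0 < f x := by
    obtain ⟨x, hx⟩ := x
    obtain ⟨v, hv, rfl⟩ := exists_of_mem_TruncF hx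
    simpa only [f, emb_injective.extend_apply] using groundState_pos hv
  have heig : (HMat 0 (TruncF (k + 1)) fun _ => 0).mulVec f = energy k • f := by
    ext ⟨x, hx⟩
    obtain ⟨v, hv, rfl⟩ := exists_of_mem_TruncF hx
    rw [mulVec_HMat_emb (fun u hu => groundState_eq_zero hu), sum_nbr_groundState hv]
    simp only [f, Pi.smul_apply, emb_injective.extend_apply, smul_eq_mul]
    ring
  have hmem : emb (1, 0) ∈ TruncF (k + 1) :=
    emb_mem_TruncF.2 ((isInterior_odd_even k 0 0).2 (IsBase.mono k.zero_le rfl))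
  refine ⟨energy k, ?_, ?_, ?_, ?_⟩
  · refine Module.End.hasEigenvalue_of_hasEigenvector (x := f)
      ⟨Module.End.mem_eigenspace_iff.2 heig, fun h => ?_⟩
    exact (hpos ⟨_, hmem⟩).ne' (congrFun h _)
  · refine fun μ hμ => le_of_hasEigenvalue_of_pos (fun x y hxy => ?_) hpos heig hμ
    simp only [HMat, if_neg (Subtype.coe_injective.ne hxy)]
    split_ifs <;> norm_num
  · rw [hpow, mul_one_div, div_le_iff₀ (by positivity), pow_succ]
    linarith [le_energy_mul_pow k]
  · rw [hpow, mul_one_div, le_div_iff₀ (by positivity), pow_succ]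
    linarith [energy_mul_pow_le k, (energy_mem k).1]
end
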